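/- arXiv:1802.08853 — 3 statements merged into one kernel-verified Lean document; each statement's English description precedes it below -/
import Mathlib

section
/- Let 𝒜 be a unital associative ℂ-algebra and let U : ℂ∖{0} → M₂(𝒜) satisfy the reflection equation. Given ζ₊, κ₊, τ₊ ∈ ℂ with ζ₊² ∉ {0,1}, set K₊(λ) = K(qλ; ζ₊, κ₊, τ₊) and define the boundary transfer matrix 𝒯(λ) = Σ_{i,j∈{1,2}} (K₊(λ))_{i,j}·(U(λ))_{j,i} ∈ 𝒜. Then the transfer matrices commute: 𝒯(λ)𝒯(μ) = 𝒯(μ)𝒯(λ) for all λ, μ ∈ ℂ∖{0} such that both (λ/μ)² and (λμ)² lie outside the set {1, q, q^{−1}, q², q^{−2}, q³, q^{−3}, q⁴, q^{−4}}. -/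
/-- The 6-vertex `R`-matrix `R(x)` acting on `ℂ² ⊗ ℂ²` (basis indexed by
`Fin 2 × Fin 2`). -/
noncomputable def Rmat (q x : ℂ) : Matrix (Fin 2 × Fin 2) (Fin 2 × Fin 2) ℂ :=
  Matrix.of fun i j : Fin 2 × Fin 2 =>
    if i = j then (if i.1 = i.2 then q * x - (q * x)⁻¹ else x - x⁻¹)
    else if i.1 = j.2 ∧ i.2 = j.1 ∧ i.1 ≠ i.2 then q - q⁻¹
    else 0

/-- `W₁ = W ⊗ I₂` as a `4×4` matrix over `A`. -/
noncomputable def kron1 {A : Type*} [Ring A] (W : Matrix (Fin 2) (Fin 2) A) :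
    Matrix (Fin 2 × Fin 2) (Fin 2 × Fin 2) A :=
  Matrix.kroneckerMap (· * ·) W (1 : Matrix (Fin 2) (Fin 2) A)

/-- `W₂ = I₂ ⊗ W` as a `4×4` matrix over `A`. -/
noncomputable def kron2 {A : Type*} [Ring A] (W : Matrix (Fin 2) (Fin 2) A) :
    Matrix (Fin 2 × Fin 2) (Fin 2 × Fin 2) A :=
  Matrix.kroneckerMap (· * ·) (1 : Matrix (Fin 2) (Fin 2) A) W

/-- `U : ℂ∖{0} → M₂(𝒜)` satisfies the reflection equation
`R(λ/μ) U₁(λ) R(λμ/q) U₂(μ) = U₂(μ) R(λμ/q) U₁(λ) R(λ/μ)`. -/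
def ReflEq (q : ℂ) {A : Type*} [Ring A] [Algebra ℂ A]
    (U : ℂ → Matrix (Fin 2) (Fin 2) A) : Prop :=
  ∀ lam mu : ℂ, lam ≠ 0 → mu ≠ 0 →
    (Rmat q (lam / mu)).map (algebraMap ℂ A) * kron1 (U lam) *
        (Rmat q (lam * mu / q)).map (algebraMap ℂ A) * kron2 (U mu) =
      kron2 (U mu) * (Rmat q (lam * mu / q)).map (algebraMap ℂ A) * kron1 (U lam) *
        (Rmat q (lam / mu)).map (algebraMap ℂ A)

/-- The boundary `K`-matrix `K(λ; ζ, κ, t)`. -/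
noncomputable def Kmat (q sq z k t : ℂ) (lam : ℂ) : Matrix (Fin 2) (Fin 2) ℂ :=
  (z - z⁻¹)⁻¹ •
    !![lam * z / sq - sq / (lam * z), k * Complex.exp t * (lam ^ 2 / q - q / lam ^ 2);
       k * Complex.exp (-t) * (lam ^ 2 / q - q / lam ^ 2), sq * z / lam - lam / (z * sq)]

/-- The set `{1, q^{±1}, q^{±2}, q^{±3}, q^{±4}}` of excluded values. -/
noncomputable def excl (q : ℂ) : Set ℂ :=
  {1, q, q⁻¹, q ^ 2, (q ^ 2)⁻¹, q ^ 3, (q ^ 3)⁻¹, q ^ 4, (q ^ 4)⁻¹}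

/-- The shape of a six-vertex matrix with weights `a, b, c`. -/
noncomputable def R6 (a b c : ℂ) : Matrix (Fin 2 × Fin 2) (Fin 2 × Fin 2) ℂ :=
  Matrix.of fun i j : Fin 2 × Fin 2 =>
    if i = j then (if i.1 = i.2 then a else b)
    else if i.1 = j.2 ∧ i.2 = j.1 ∧ i.1 ≠ i.2 then c
    else 0

lemma Rmat_eq_R6 (q x : ℂ) : Rmat q x = R6 (q * x - (q * x)⁻¹) (x - x⁻¹) (q - q⁻¹) := rfl

/-- Solves `tr (Y U₁ R V₂) = b e (tr K U) (tr L V)`. -/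
noncomputable def Ymat (a c e : ℂ) (K L : Matrix (Fin 2) (Fin 2) ℂ) :
    Matrix (Fin 2 × Fin 2) (Fin 2 × Fin 2) ℂ :=
  Matrix.of fun i j : Fin 2 × Fin 2 =>
    if i.1 = j.2 then a * (K i.1 j.1 * L i.2 i.1) - c * (K (1 - i.1) j.1 * L i.2 (1 - i.1))
    else e * (K i.1 j.1 * L i.2 j.2)

/-- Solves `tr (Z V₂ R U₁) = b e (tr L V) (tr K U)`. -/
noncomputable def Zmat (a c e : ℂ) (K L : Matrix (Fin 2) (Fin 2) ℂ) :
    Matrix (Fin 2 × Fin 2) (Fin 2 × Fin 2) ℂ :=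
  Matrix.of fun i j : Fin 2 × Fin 2 =>
    if i.2 = j.1 then a * (L i.2 j.2 * K i.1 i.2) - c * (L (1 - i.2) j.2 * K i.1 (1 - i.2))
    else e * (L i.2 j.2 * K i.1 j.1)

lemma R6_inv (a b c : ℂ) :
    R6 a b c * R6 (b ^ 2 - c ^ 2) (a * b) (-(a * c)) =
      (a * (b ^ 2 - c ^ 2)) • (1 : Matrix (Fin 2 × Fin 2) (Fin 2 × Fin 2) ℂ) := by
  ext ⟨i, j⟩ ⟨k, l⟩
  fin_cases i <;> fin_cases j <;> fin_cases k <;> fin_cases l <;>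
    simp [R6, Matrix.mul_apply, Fintype.sum_prod_type] <;> ring

lemma R6_inv' (a b c : ℂ) :
    R6 (b ^ 2 - c ^ 2) (a * b) (-(a * c)) * R6 a b c =
      (a * (b ^ 2 - c ^ 2)) • (1 : Matrix (Fin 2 × Fin 2) (Fin 2 × Fin 2) ℂ) := by
  ext ⟨i, j⟩ ⟨k, l⟩
  fin_cases i <;> fin_cases j <;> fin_cases k <;> fin_cases l <;>
    simp [R6, Matrix.mul_apply, Fintype.sum_prod_type] <;> ring

section tr
variable {A : Type*} [Ring A] [Algebra ℂ A]

lemma alg_l (r : ℂ) (x : A) : algebraMap ℂ A r * x = r • x := (Algebra.smul_def r x).symm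
lemma alg_r (r : ℂ) (x : A) : x * algebraMap ℂ A r = r • x := by
  rw [← Algebra.commutes, alg_l]

lemma trace_scalar_comm (X : Matrix (Fin 2 × Fin 2) (Fin 2 × Fin 2) ℂ)
    (M : Matrix (Fin 2 × Fin 2) (Fin 2 × Fin 2) A) :
    (X.map (algebraMap ℂ A) * M).trace = (M * X.map (algebraMap ℂ A)).trace := by
  simp only [Matrix.trace, Matrix.diag, Matrix.mul_apply, Matrix.map_apply]
  rw [Finset.sum_comm]
  simp only [Algebra.commutes]

lemma trY (a b c e : ℂ) (h : b * e = a ^ 2 - c ^ 2) (K L : Matrix (Fin 2) (Fin 2) ℂ)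
    (U V : Matrix (Fin 2) (Fin 2) A) :
    ((Ymat a c e K L).map (algebraMap ℂ A) *
      (kron1 U * (R6 a b c).map (algebraMap ℂ A) * kron2 V)).trace =
    (b * e) • ((∑ i : Fin 2, ∑ j : Fin 2, K i j • U j i) *
      (∑ i : Fin 2, ∑ j : Fin 2, L i j • V j i)) := by
  simp [Matrix.trace, Matrix.mul_apply, Fintype.sum_prod_type, kron1, kron2, R6, Ymat,
    Matrix.one_apply, alg_r, ← Algebra.smul_def, -map_sub, -map_mul, -map_add, mul_add, add_mul]
  match_scalars <;> first
    | ring1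
    | linear_combination -(K 0 0 * L 0 0) * h
    | linear_combination -(K 0 0 * L 1 0) * h
    | linear_combination -(K 0 1 * L 0 0) * h
    | linear_combination -(K 0 1 * L 1 0) * h
    | linear_combination -(K 1 0 * L 0 1) * h
    | linear_combination -(K 1 0 * L 1 1) * h
    | linear_combination -(K 1 1 * L 0 1) * h
    | linear_combination -(K 1 1 * L 1 1) * h

lemma trZ (a b c e : ℂ) (h : b * e = a ^ 2 - c ^ 2) (K L : Matrix (Fin 2) (Fin 2) ℂ)
    (U V : Matrix (Fin 2) (Fin 2) A) :
    ((Zmat a c e K L).map (algebraMap ℂ A) *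
      (kron2 V * (R6 a b c).map (algebraMap ℂ A) * kron1 U)).trace =
    (b * e) • ((∑ i : Fin 2, ∑ j : Fin 2, L i j • V j i) *
      (∑ i : Fin 2, ∑ j : Fin 2, K i j • U j i)) := by
  simp [Matrix.trace, Matrix.mul_apply, Fintype.sum_prod_type, kron1, kron2, R6, Zmat,
    Matrix.one_apply, alg_r, ← Algebra.smul_def, -map_sub, -map_mul, -map_add, mul_add, add_mul]
  match_scalars <;> first
    | ring1
    | linear_combination -(K 0 0 * L 0 0) * h
    | linear_combination -(K 0 0 * L 0 1) * h
    | linear_combination -(K 1 0 * L 0 0) * h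
    | linear_combination -(K 1 0 * L 0 1) * h
    | linear_combination -(K 0 1 * L 1 0) * h
    | linear_combination -(K 0 1 * L 1 1) * h
    | linear_combination -(K 1 1 * L 1 0) * h
    | linear_combination -(K 1 1 * L 1 1) * h
lemma comm_of_dual (a b c e a' b' : ℂ) (hne : b * e ≠ 0) (hne' : a' * (b' ^ 2 - c ^ 2) ≠ 0)
    (hbe : b * e = a ^ 2 - c ^ 2) (K L : Matrix (Fin 2) (Fin 2) ℂ)
    (U V : Matrix (Fin 2) (Fin 2) A)
    (hE : (R6 a' b' c).map (algebraMap ℂ A) * kron1 U * (R6 a b c).map (algebraMap ℂ A) * kron2 V =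
      kron2 V * (R6 a b c).map (algebraMap ℂ A) * kron1 U * (R6 a' b' c).map (algebraMap ℂ A))
    (hD : R6 a' b' c * Ymat a c e K L = Zmat a c e K L * R6 a' b' c) :
    (∑ i : Fin 2, ∑ j : Fin 2, K i j • U j i) * (∑ i : Fin 2, ∑ j : Fin 2, L i j • V j i) =
    (∑ i : Fin 2, ∑ j : Fin 2, L i j • V j i) * (∑ i : Fin 2, ∑ j : Fin 2, K i j • U j i) := by
  have hY := trY a b c e hbe K L U V
  have hZ := trZ a b c e hbe K L U V
  set X := Ymat a c e K L * R6 (b' ^ 2 - c ^ 2) (a' * b') (-(a' * c)) with hX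
  have hXR : X * R6 a' b' c = (a' * (b' ^ 2 - c ^ 2)) • Ymat a c e K L := by
    rw [hX, Matrix.mul_assoc, R6_inv', Matrix.mul_smul, Matrix.mul_one]
  have hRX : R6 a' b' c * X = (a' * (b' ^ 2 - c ^ 2)) • Zmat a c e K L := by
    rw [hX, ← Matrix.mul_assoc, hD, Matrix.mul_assoc, R6_inv, Matrix.mul_smul, Matrix.mul_one]
  have key : (X.map (algebraMap ℂ A) * ((R6 a' b' c).map (algebraMap ℂ A) *
      (kron1 U * (R6 a b c).map (algebraMap ℂ A) * kron2 V))).trace =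
      ((R6 a' b' c).map (algebraMap ℂ A) * (X.map (algebraMap ℂ A) *
      (kron2 V * (R6 a b c).map (algebraMap ℂ A) * kron1 U))).trace := by
    rw [trace_scalar_comm (R6 a' b' c)]
    simp only [← Matrix.mul_assoc] at hE ⊢
    congr 1
    simp only [Matrix.mul_assoc] at hE ⊢
    rw [hE]
  have map_smul' : ∀ (r : ℂ) (M : Matrix (Fin 2 × Fin 2) (Fin 2 × Fin 2) ℂ),
      (r • M).map (algebraMap ℂ A) = r • M.map (algebraMap ℂ A) := by
    intro r M
    ext i j
    rw [Matrix.map_apply, Matrix.smul_apply, Matrix.smul_apply, Matrix.map_apply, smul_eq_mul,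
      map_mul, Algebra.smul_def]
  rw [← Matrix.mul_assoc (X.map (algebraMap ℂ A)), ← Matrix.map_mul,
    ← Matrix.mul_assoc ((R6 a' b' c).map (algebraMap ℂ A)), ← Matrix.map_mul, hXR, hRX,
    map_smul', map_smul', Matrix.smul_mul, Matrix.smul_mul, Matrix.trace_smul, Matrix.trace_smul,
    hY, hZ] at key
  exact smul_right_injective A hne (smul_right_injective A hne' key)
end tr

noncomputable def K0 (s z g h l : ℂ) : Matrix (Fin 2) (Fin 2) ℂ :=
  !![s * l * z - (s * l * z)⁻¹, g * (s ^ 2 * l ^ 2 - (s ^ 2 * l ^ 2)⁻¹);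
     h * (s ^ 2 * l ^ 2 - (s ^ 2 * l ^ 2)⁻¹), z * (s * l)⁻¹ - s * l * z⁻¹]

lemma dual (s z g h l m : ℂ) (hs : s ≠ 0) (hz : z ≠ 0) (hl : l ≠ 0) (hm : m ≠ 0) :
    R6 (s ^ 2 * (l / m) - (s ^ 2 * (l / m))⁻¹) (l / m - (l / m)⁻¹) (s ^ 2 - (s ^ 2)⁻¹) *
      Ymat (l * m - (l * m)⁻¹) (s ^ 2 - (s ^ 2)⁻¹) (s ^ 2 * l * m - (s ^ 2 * l * m)⁻¹)
        (K0 s z g h l) (K0 s z g h m) =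
    Zmat (l * m - (l * m)⁻¹) (s ^ 2 - (s ^ 2)⁻¹) (s ^ 2 * l * m - (s ^ 2 * l * m)⁻¹)
        (K0 s z g h l) (K0 s z g h m) *
    R6 (s ^ 2 * (l / m) - (s ^ 2 * (l / m))⁻¹) (l / m - (l / m)⁻¹) (s ^ 2 - (s ^ 2)⁻¹) := by
  ext ⟨i, j⟩ ⟨k, n⟩
  fin_cases i <;> fin_cases j <;> fin_cases k <;> fin_cases n <;>
    simp [R6, Ymat, Zmat, K0, Matrix.mul_apply, Fintype.sum_prod_type] <;> field_simp <;> ring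

lemma Kmat_eq (s z k t l : ℂ) (hs : s ≠ 0) (hz : z ≠ 0) (hl : l ≠ 0) :
    Kmat (s ^ 2) s z k t (s ^ 2 * l) =
      (z - z⁻¹)⁻¹ • K0 s z (k * Complex.exp t) (k * Complex.exp (-t)) l := by
  unfold Kmat K0
  congr 1
  ext i j
  fin_cases i <;> fin_cases j <;> simp <;> field_simp <;> simp

lemma sub_inv_ne {x : ℂ} (hx : x ≠ 0) (h : x ^ 2 ≠ 1) : x - x⁻¹ ≠ 0 := by
  intro h0
  apply h
  field_simp at h0
  linear_combination h0

/-- The boundary transfer matrices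
`𝒯(λ) = Σ_{i,j} (K₊(λ))_{i,j} (U(λ))_{j,i}` (with `K₊(λ) = K(qλ; ζ₊, κ₊, τ₊)`)
built from a solution `U` of the reflection equation commute:
`𝒯(λ)𝒯(μ) = 𝒯(μ)𝒯(λ)` whenever `(λ/μ)²` and `(λμ)²` avoid
`{1, q^{±1}, q^{±2}, q^{±3}, q^{±4}}`. -/
theorem stmt_11 (q sq : ℂ) (hq0 : q ≠ 0) (hsq : sq ^ 2 = q)
    (hqroot : ∀ n : ℕ, 1 ≤ n → n ≤ 8 → q ^ n ≠ 1)
    {A : Type*} [Ring A] [Algebra ℂ A]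
    (U : ℂ → Matrix (Fin 2) (Fin 2) A) (hU : ReflEq q U)
    (zp kp tp : ℂ) (hz0 : zp ^ 2 ≠ 0) (hz1 : zp ^ 2 ≠ 1) :
    ∀ lam mu : ℂ, lam ≠ 0 → mu ≠ 0 →
      (lam / mu) ^ 2 ∉ excl q → (lam * mu) ^ 2 ∉ excl q →
      (∑ i : Fin 2, ∑ j : Fin 2, Kmat q sq zp kp tp (q * lam) i j • U lam j i) *
        (∑ i : Fin 2, ∑ j : Fin 2, Kmat q sq zp kp tp (q * mu) i j • U mu j i) =
      (∑ i : Fin 2, ∑ j : Fin 2, Kmat q sq zp kp tp (q * mu) i j • U mu j i) *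
        (∑ i : Fin 2, ∑ j : Fin 2, Kmat q sq zp kp tp (q * lam) i j • U lam j i) := by
  intro lam mu hl hm h1 h2
  subst hsq
  have hs : sq ≠ 0 := by
    rintro rfl
    simp at hq0
  have hz : zp ≠ 0 := by
    rintro rfl
    simp at hz0
  simp only [excl, Set.mem_insert_iff, Set.mem_singleton_iff, not_or] at h1 h2
  obtain ⟨-, -, -, h1a, h1b, -⟩ := h1
  obtain ⟨-, -, -, h2a, h2b, -⟩ := h2
  rw [Kmat_eq _ _ _ _ _ hs hz hl, Kmat_eq _ _ _ _ _ hs hz hm]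
  set g := kp * Complex.exp tp
  set h := kp * Complex.exp (-tp)
  simp only [Matrix.smul_apply, smul_eq_mul, mul_smul, ← Finset.smul_sum]
  rw [smul_mul_smul_comm, smul_mul_smul_comm]
  congr 1
  have hE := hU lam mu hl hm
  rw [Rmat_eq_R6, Rmat_eq_R6] at hE
  have e1 : sq ^ 2 * (lam * mu / sq ^ 2) = lam * mu := by field_simp
  rw [e1] at hE
  have hD := dual sq zp g h lam mu hs hz hl hm
  set K := K0 sq zp g h lam
  set L := K0 sq zp g h mu
  -- the weights
  have hlm : lam / mu ≠ 0 := div_ne_zero hl hm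
  have hlm' : lam * mu ≠ 0 := mul_ne_zero hl hm
  have na : sq ^ 2 * (lam / mu) - (sq ^ 2 * (lam / mu))⁻¹ ≠ 0 := by
    refine sub_inv_ne (mul_ne_zero hq0 hlm) fun h0 => h1b ?_
    rw [mul_pow] at h0
    exact eq_inv_of_mul_eq_one_right h0
  have nbc : (lam / mu - (lam / mu)⁻¹) ^ 2 - (sq ^ 2 - (sq ^ 2)⁻¹) ^ 2 ≠ 0 := by
    have : (lam / mu - (lam / mu)⁻¹) ^ 2 - (sq ^ 2 - (sq ^ 2)⁻¹) ^ 2 =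
        (sq ^ 2 * (lam / mu) - (sq ^ 2 * (lam / mu))⁻¹) *
          (lam / mu / sq ^ 2 - (lam / mu / sq ^ 2)⁻¹) := by
      field_simp
      ring
    rw [this]
    refine mul_ne_zero na (sub_inv_ne (div_ne_zero hlm hq0) fun h0 => h1a ?_)
    rw [div_pow] at h0
    exact (div_eq_one_iff_eq (pow_ne_zero _ hq0)).1 h0
  have nb : lam * mu / sq ^ 2 - (lam * mu / sq ^ 2)⁻¹ ≠ 0 := by
    refine sub_inv_ne (div_ne_zero hlm' hq0) fun h0 => h2a ?_
    rw [div_pow] at h0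
    exact (div_eq_one_iff_eq (pow_ne_zero _ hq0)).1 h0
  have ne : sq ^ 2 * lam * mu - (sq ^ 2 * lam * mu)⁻¹ ≠ 0 := by
    rw [mul_assoc]
    refine sub_inv_ne (mul_ne_zero hq0 hlm') fun h0 => h2b ?_
    rw [mul_pow] at h0
    exact eq_inv_of_mul_eq_one_right h0
  have hbe : (lam * mu / sq ^ 2 - (lam * mu / sq ^ 2)⁻¹) *
      (sq ^ 2 * lam * mu - (sq ^ 2 * lam * mu)⁻¹) =
      (lam * mu - (lam * mu)⁻¹) ^ 2 - (sq ^ 2 - (sq ^ 2)⁻¹) ^ 2 := by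
    field_simp
    ring
  generalize sq ^ 2 * (lam / mu) - (sq ^ 2 * (lam / mu))⁻¹ = a' at *
  generalize lam / mu - (lam / mu)⁻¹ = b' at *
  generalize lam * mu / sq ^ 2 - (lam * mu / sq ^ 2)⁻¹ = b at *
  generalize sq ^ 2 * lam * mu - (sq ^ 2 * lam * mu)⁻¹ = e at *
  generalize lam * mu - (lam * mu)⁻¹ = a at *
  generalize sq ^ 2 - (sq ^ 2)⁻¹ = c at *
  exact comm_of_dual a b c e a' b' (mul_ne_zero nb ne) (mul_ne_zero na nbc) hbe K L
    (U lam) (U mu) hE hD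
end

section
/- Let 𝒜 be a unital associative ℂ-algebra and let U : ℂ∖{0} → M₂(𝒜) satisfy the reflection equation; write A₋(λ) = U(λ)₁₁, B₋(λ) = U(λ)₁₂, C₋(λ) = U(λ)₂₁, D₋(λ) = U(λ)₂₂. (i) For every λ ∈ ℂ∖{0} with λ⁴ ∉ {1, q², q^{−2}, q⁴, q^{−4}}: A₋(q^{1/2}λ)A₋(q^{1/2}/λ) + B₋(q^{1/2}λ)C₋(q^{1/2}/λ) = D₋(q^{1/2}λ)D₋(q^{1/2}/λ) + C₋(q^{1/2}λ)B₋(q^{1/2}/λ). (ii) Defining the boundary quantum determinant det_q U(λ) = ((λ/q)² − (q/λ)²)·[A₋(q^{1/2}λ)A₋(q^{1/2}/λ) + B₋(q^{1/2}λ)C₋(q^{1/2}/λ)], it is central: det_q U(λ)·(U(μ))_{i,j} = (U(μ))_{i,j}·det_q U(λ) for all i, j ∈ {1,2} and all λ, μ ∈ ℂ∖{0} such that λ⁴ ∉ {1, q^{±2}, q^{±4}} and, for each choice of signs, (λ q^{±1/2}/μ)² and (λ q^{±1/2} μ)² lie outside {1, q^{±1}, q^{±2}, q^{±3}, q^{±4}}.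 -/
lemma kron1_mul_aux {A : Type*} [Ring A] (V W : Matrix (Fin 2) (Fin 2) A) :
    kron1 V * kron1 W = kron1 (V * W) := by
  ext ⟨i, i'⟩ ⟨j, j'⟩
  fin_cases i <;> fin_cases i' <;> fin_cases j <;> fin_cases j' <;>
    simp [kron1, Matrix.mul_apply, Fintype.sum_prod_type]

lemma kron1_scalar_aux {A : Type*} [Ring A] (d : A) :
    kron1 (Matrix.scalar (Fin 2) d) = Matrix.scalar (Fin 2 × Fin 2) d := by
  ext ⟨i, i'⟩ ⟨j, j'⟩
  fin_cases i <;> fin_cases i' <;> fin_cases j <;> fin_cases j' <;>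
    simp [kron1]

lemma Rmat_inv_aux (q x y : ℂ) (hq : q ≠ 0) (hx : x ≠ 0) (hxy : y = x⁻¹) :
    Rmat q x * Rmat q y
      = ((q * x - (q * x)⁻¹) * (q * y - (q * y)⁻¹)) • 1 := by
  subst hxy
  ext ⟨i, i'⟩ ⟨j, j'⟩
  fin_cases i <;> fin_cases i' <;> fin_cases j <;> fin_cases j' <;>
    simp [Rmat, Matrix.mul_apply, Fintype.sum_prod_type] <;> field_simp <;> ring

lemma Rmap_inv_aux {A : Type*} [Ring A] [Algebra ℂ A] (q x y : ℂ) (hq : q ≠ 0) (hx : x ≠ 0)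
    (hxy : y = x⁻¹) :
    (Rmat q x).map (algebraMap ℂ A) * (Rmat q y).map (algebraMap ℂ A)
      = ((q * x - (q * x)⁻¹) * (q * y - (q * y)⁻¹)) • 1 := by
  rw [← Matrix.map_mul, Rmat_inv_aux q x y hq hx hxy]
  generalize (q * x - (q * x)⁻¹) * (q * y - (q * y)⁻¹) = s
  ext i j
  by_cases h : i = j <;> simp [h, Matrix.one_apply, Algebra.algebraMap_eq_smul_one]

lemma Rone_aux1 {A : Type*} [Ring A] [Algebra ℂ A] (q : ℂ)
    (V W : Matrix (Fin 2) (Fin 2) A) :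
    kron1 V * (Rmat q 1).map (algebraMap ℂ A) * kron2 W
      = kron1 (V * W) * (Rmat q 1).map (algebraMap ℂ A) := by
  generalize hc : algebraMap ℂ A (q - q⁻¹) = c
  have hcc : ∀ a : A, c * a = a * c := fun a => by rw [← hc]; exact Algebra.commutes _ _
  ext ⟨i, i'⟩ ⟨j, j'⟩
  fin_cases i <;> fin_cases i' <;> fin_cases j <;> fin_cases j' <;>
    simp [kron1, kron2, Rmat, Matrix.mul_apply, Fintype.sum_prod_type, -map_sub, hc, mul_assoc,
      hcc, add_mul]

lemma Rone_aux2 {A : Type*} [Ring A] [Algebra ℂ A] (q : ℂ)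
    (V W : Matrix (Fin 2) (Fin 2) A) :
    kron2 W * (Rmat q 1).map (algebraMap ℂ A) * kron1 V
      = kron2 (W * V) * (Rmat q 1).map (algebraMap ℂ A) := by
  generalize hc : algebraMap ℂ A (q - q⁻¹) = c
  have hcc : ∀ a : A, c * a = a * c := fun a => by rw [← hc]; exact Algebra.commutes _ _
  ext ⟨i, i'⟩ ⟨j, j'⟩
  fin_cases i <;> fin_cases i' <;> fin_cases j <;> fin_cases j' <;>
    simp [kron1, kron2, Rmat, Matrix.mul_apply, Fintype.sum_prod_type, -map_sub, hc, mul_assoc,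
      hcc, add_mul]

lemma Rmap_one_aux {A : Type*} [Ring A] [Algebra ℂ A] (q : ℂ)
    (V W : Matrix (Fin 2) (Fin 2) A) (x : ℂ)
    (h : (Rmat q x).map (algebraMap ℂ A) * kron1 V *
        (Rmat q 1).map (algebraMap ℂ A) * kron2 W =
      kron2 W * (Rmat q 1).map (algebraMap ℂ A) * kron1 V *
        (Rmat q x).map (algebraMap ℂ A)) (hc : q - q⁻¹ ≠ 0) (hb : x - x⁻¹ ≠ 0) :
    V * W = Matrix.scalar (Fin 2) ((V * W) 0 0) := by
  have e : ∀ (c : ℂ) (a b : A), c ≠ 0 → a * algebraMap ℂ A c = b * algebraMap ℂ A c → a = b := by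
    intro c a b hc h
    rw [← Algebra.commutes, ← Algebra.commutes, ← Algebra.smul_def, ← Algebra.smul_def] at h
    exact (smul_right_inj hc).1 h
  rw [mul_assoc, mul_assoc, ← mul_assoc (kron1 V), Rone_aux1, Rone_aux2] at h
  generalize V * W = M at h ⊢
  generalize W * V = N at h
  have hcc : ∀ (z : ℂ) (a : A), algebraMap ℂ A z * a = a * algebraMap ℂ A z :=
    fun z a => Algebra.commutes _ _
  have h1 := congrFun (congrFun h (0, 1)) (1, 1)
  have h2 := congrFun (congrFun h (0, 1)) (0, 1)
  have h3 := congrFun (congrFun h (0, 1)) (1, 0)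
  have h4 := congrFun (congrFun h (1, 0)) (0, 0)
  simp [kron1, kron2, Rmat, Matrix.mul_apply, Fintype.sum_prod_type, -map_sub, hcc] at h1 h2 h3 h4
  have g1 : M 0 1 = 0 := e _ _ _ hc (e _ _ _ hb (by rw [h1]; simp))
  have g4 : M 1 0 = 0 := e _ _ _ hc (e _ _ _ hb (by rw [h4]; simp))
  have g2 : M 1 1 = N 1 1 := e _ _ _ hc (e _ _ _ hc h2)
  have g3 : M 0 0 = N 1 1 := e _ _ _ hc (e _ _ _ hb h3)
  ext i j
  fin_cases i <;> fin_cases j <;> simp [g1, g2, g3, g4]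

/-- For a solution `U` of the reflection equation, with
`A₋ = U₁₁, B₋ = U₁₂, C₋ = U₂₁, D₋ = U₂₂`:
(i) `A₋(q^{1/2}λ)A₋(q^{1/2}/λ) + B₋(q^{1/2}λ)C₋(q^{1/2}/λ)
   = D₋(q^{1/2}λ)D₋(q^{1/2}/λ) + C₋(q^{1/2}λ)B₋(q^{1/2}/λ)`;
(ii) the boundary quantum determinant
`det_q U(λ) = ((λ/q)² − (q/λ)²)[A₋(q^{1/2}λ)A₋(q^{1/2}/λ) + B₋(q^{1/2}λ)C₋(q^{1/2}/λ)]`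
is central. -/
theorem stmt_12 (q sq : ℂ) (hq0 : q ≠ 0) (hsq : sq ^ 2 = q)
    (hqroot : ∀ n : ℕ, 1 ≤ n → n ≤ 8 → q ^ n ≠ 1)
    {A : Type*} [Ring A] [Algebra ℂ A]
    (U : ℂ → Matrix (Fin 2) (Fin 2) A) (hU : ReflEq q U) :
    (∀ lam : ℂ, lam ≠ 0 →
      lam ^ 4 ∉ ({1, q ^ 2, (q ^ 2)⁻¹, q ^ 4, (q ^ 4)⁻¹} : Set ℂ) →
      U (sq * lam) 0 0 * U (sq / lam) 0 0 + U (sq * lam) 0 1 * U (sq / lam) 1 0 =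
        U (sq * lam) 1 1 * U (sq / lam) 1 1 + U (sq * lam) 1 0 * U (sq / lam) 0 1) ∧
    (∀ lam mu : ℂ, lam ≠ 0 → mu ≠ 0 →
      lam ^ 4 ∉ ({1, q ^ 2, (q ^ 2)⁻¹, q ^ 4, (q ^ 4)⁻¹} : Set ℂ) →
      (lam * sq / mu) ^ 2 ∉ excl q → (lam / (sq * mu)) ^ 2 ∉ excl q →
      (lam * sq * mu) ^ 2 ∉ excl q → (lam * mu / sq) ^ 2 ∉ excl q →
      ∀ i j : Fin 2,
        (((lam / q) ^ 2 - (q / lam) ^ 2) •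
            (U (sq * lam) 0 0 * U (sq / lam) 0 0 + U (sq * lam) 0 1 * U (sq / lam) 1 0)) *
          U mu i j =
        U mu i j *
          (((lam / q) ^ 2 - (q / lam) ^ 2) •
            (U (sq * lam) 0 0 * U (sq / lam) 0 0 + U (sq * lam) 0 1 * U (sq / lam) 1 0))) := by
  have hs0 : sq ≠ 0 := by rintro rfl; simp at hsq; exact hq0 hsq.symm
  have hc : q - q⁻¹ ≠ 0 := by
    intro h
    apply hqroot 2 (by norm_num) (by norm_num)
    field_simp at h
    linear_combination h
  have key : ∀ lam : ℂ, lam ≠ 0 →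
      lam ^ 4 ∉ ({1, q ^ 2, (q ^ 2)⁻¹, q ^ 4, (q ^ 4)⁻¹} : Set ℂ) →
      U (sq * lam) * U (sq / lam) =
        Matrix.scalar (Fin 2) ((U (sq * lam) * U (sq / lam)) 0 0) := by
    intro lam hl hl4
    have h := hU (sq * lam) (sq / lam) (mul_ne_zero hs0 hl) (div_ne_zero hs0 hl)
    have e1 : sq * lam * (sq / lam) / q = 1 := by rw [← hsq]; field_simp
    rw [e1] at h
    refine Rmap_one_aux q _ _ _ h hc ?_
    have e2 : sq * lam / (sq / lam) = lam ^ 2 := by field_simp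
    rw [e2]
    intro h0
    apply hl4
    left
    field_simp at h0
    linear_combination h0
  refine ⟨?_, ?_⟩
  · intro lam hl hl4
    have h := key lam hl hl4
    have h1 := congrFun (congrFun h 1) 1
    simp [Matrix.mul_apply] at h1
    rw [← h1, add_comm]
  · intro lam mu hl hm hl4 hy _ _ hz i j
    have h := key lam hl hl4
    have hd : U (sq * lam) 0 0 * U (sq / lam) 0 0 + U (sq * lam) 0 1 * U (sq / lam) 1 0
        = (U (sq * lam) * U (sq / lam)) 0 0 := by simp [Matrix.mul_apply]
    rw [hd, smul_mul_assoc, mul_smul_comm]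
    congr 1
    generalize (U (sq * lam) * U (sq / lam)) 0 0 = d at h ⊢
    have r1 := hU (sq * lam) mu (mul_ne_zero hs0 hl) hm
    have r2 := hU (sq / lam) mu (div_ne_zero hs0 hl) hm
    set y := lam * sq / mu with hydef
    set z := lam * mu / sq with hzdef
    have hy0 : y ≠ 0 := by positivity
    have hz0 : z ≠ 0 := by positivity
    have a1 : sq * lam / mu = y := by rw [hydef]; ring
    have a2 : sq * lam * mu / q = z := by rw [hzdef, ← hsq]; field_simp
    have a3 : sq / lam / mu = z⁻¹ := by rw [hzdef]; field_simp
    have a4 : sq / lam * mu / q = y⁻¹ := by rw [hydef, ← hsq]; field_simp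
    rw [a1, a2] at r1
    rw [a3, a4] at r2
    have ne : ∀ x : ℂ, x ≠ 0 → x ^ 2 ∉ excl q →
        (q * x - (q * x)⁻¹) * (q * x⁻¹ - (q * x⁻¹)⁻¹) ≠ 0 := by
      intro x hx hxe h0
      apply hxe
      rcases mul_eq_zero.1 h0 with h0 | h0
      · have : x ^ 2 = (q ^ 2)⁻¹ := by
          field_simp at h0 ⊢
          linear_combination h0
        simp [excl, this]
      · have : x ^ 2 = q ^ 2 := by
          field_simp at h0 ⊢
          linear_combination -h0
        simp [excl, this]
    have uy := Rmap_inv_aux (A := A) q y y⁻¹ hq0 hy0 rfl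
    have uz := Rmap_inv_aux (A := A) q z z⁻¹ hq0 hz0 rfl
    have ney := ne y hy0 hy
    have nez := ne z hz0 hz
    generalize (q * y - (q * y)⁻¹) * (q * y⁻¹ - (q * y⁻¹)⁻¹) = s at uy ney
    generalize (q * z - (q * z)⁻¹) * (q * z⁻¹ - (q * z⁻¹)⁻¹) = t at uz nez
    have hk : kron1 (U (sq * lam)) * kron1 (U (sq / lam)) = Matrix.scalar (Fin 2 × Fin 2) d := by
      rw [kron1_mul_aux, h, kron1_scalar_aux]
    have comm : ∀ x : ℂ, (Rmat q x).map (algebraMap ℂ A) * Matrix.scalar (Fin 2 × Fin 2) d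
        = Matrix.scalar (Fin 2 × Fin 2) d * (Rmat q x).map (algebraMap ℂ A) := by
      intro x
      ext i j
      simp [Algebra.commutes]
    have cy := comm y
    have cz := comm z
    have fin : kron2 (U mu) * Matrix.scalar (Fin 2 × Fin 2) d
        = Matrix.scalar (Fin 2 × Fin 2) d * kron2 (U mu) := by
      generalize (Rmat q y).map (algebraMap ℂ A) = Y at *
      generalize (Rmat q y⁻¹).map (algebraMap ℂ A) = Y' at *
      generalize (Rmat q z).map (algebraMap ℂ A) = Z at *
      generalize (Rmat q z⁻¹).map (algebraMap ℂ A) = Z' at *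
      generalize kron1 (U (sq * lam)) = V at *
      generalize kron1 (U (sq / lam)) = W at *
      generalize kron2 (U mu) = X at *
      generalize Matrix.scalar (Fin 2 × Fin 2) d = E at *
      have l1 : X * Z * V * Y * (Y' * W * Z') = (s * t) • (X * E) := by
        calc X * Z * V * Y * (Y' * W * Z') = X * Z * V * (Y * Y') * W * Z' := by noncomm_ring
          _ = s • (X * Z * (V * W) * Z') := by
            rw [uy]; simp [mul_assoc]
          _ = s • (X * (Z * E) * Z') := by rw [hk]; simp only [mul_assoc]
          _ = s • (X * E * (Z * Z')) := by rw [cz]; simp only [mul_assoc]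
          _ = _ := by rw [uz]; simp [smul_smul]
      have l2 : X * Z * V * Y * (Y' * W * Z') = (s * t) • (E * X) := by
        calc X * Z * V * Y * (Y' * W * Z') = Y * V * Z * X * (Y' * W * Z') := by rw [r1]
          _ = Y * V * Z * (X * Y' * W * Z') := by simp only [mul_assoc]
          _ = Y * V * (Z * Z') * W * Y' * X := by rw [← r2]; simp only [mul_assoc]
          _ = t • (Y * (V * W) * Y' * X) := by rw [uz]; simp [mul_assoc]
          _ = t • (E * (Y * Y') * X) := by rw [hk, cy]; simp only [mul_assoc]
          _ = _ := by rw [uy]; simp [smul_smul, mul_comm]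
      have l3 := l1.symm.trans l2
      exact (smul_right_inj (mul_ne_zero ney nez)).1 l3
    have := congrFun (congrFun fin (0, i)) (0, j)
    simp [kron2] at this
    exact this.symm
end

section
/- Assume a^p + b^p ≠ 0 and c^p + d^p ≠ 0, and let ρ ∈ ℂ be a p-th root of (c^p + d^p)/(a^p + b^p). For ε ∈ {+1, −1} and k ∈ {0,…,p−1} set z^{(ε,k)} = −q^{k+1/2}·(ρa/c)^{(1+ε)/2}·(𝛂/a) and w^{(ε,k)} = −q^{1/2−k}·(d/(ρb))^{(1+ε)/2}·(𝛃/d). Suppose the gauge parameters α, β, γ ∈ ℂ∖{0} with β² ≠ 1 satisfy β/α = w^{(ε,k)} and γ = z^{(ε,k)}. Define the covector ω^{(k)} : V → ℂ by ω^{(k)}(e_h) = q^{h(k+1)}·∏_{r=1}^{h} [ρ·(aq^{r−1/2} + bq^{1/2−r})/(cq^{r−1/2} + dq^{1/2−r})]^{(1+ε)/2} for h ∈ {0,…,p−1}. Then: (i) ω^{(k)} ∘ A(λ|α,β,γ) = 0 for every λ ∈ ℂ∖{0}; (ii) ω^{(k)} ∘ B(λ|α,β) = b(λ)·ω^{(k+1)}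 for every λ ∈ ℂ∖{0}, where ω^{(k+1)} is the covector defined by the same formula with k replaced by k+1, and b(λ) = (β²/(β²−1))·(q^{1/2}(ac/𝛂)/λ + (λ/q^{3/2})·ξ) with ξ = ad/𝛃 if ε = −1 and ξ = bc/𝛃 if ε = +1. -/
/-- The fixed square root `q^{1/2} := q^{(p+1)/2}` of a primitive `p`-th root of
unity `q` (`p` odd). -/
noncomputable def qhalf (p : ℕ) (q : ℂ) : ℂ := q ^ ((p + 1) / 2)

/-- The Weyl algebra generator `v` on `V = ℂ^{ℤ/pℤ}`: `v e_h = q^h e_h`. -/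
noncomputable def vOp (p : ℕ) (q : ℂ) : Matrix (ZMod p) (ZMod p) ℂ :=
  Matrix.of fun i j => if j = i then q ^ i.val else 0

/-- The inverse of `v`: `v⁻¹ e_h = q^{−h} e_h`. -/
noncomputable def vInv (p : ℕ) (q : ℂ) : Matrix (ZMod p) (ZMod p) ℂ :=
  Matrix.of fun i j => if j = i then (q ^ i.val)⁻¹ else 0

/-- The Weyl algebra generator `u` on `V = ℂ^{ℤ/pℤ}`: `u e_h = e_{h−1}`. -/
def uOp (p : ℕ) : Matrix (ZMod p) (ZMod p) ℂ :=
  Matrix.of fun i j => if j = i + 1 then 1 else 0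

/-- The inverse of `u`: `u⁻¹ e_h = e_{h+1}`. -/
def uInv (p : ℕ) : Matrix (ZMod p) (ZMod p) ℂ :=
  Matrix.of fun i j => if j = i - 1 then 1 else 0

/-- The Bazhanov–Stroganov Lax matrix `L(λ) ∈ M₂(End V)` with bulk parameters
`a, b, c, d, 𝛂 = aA, 𝛃 = bB`. -/
noncomputable def Lax (p : ℕ) [NeZero p] (q sq a b c d aA bB : ℂ) (lam : ℂ) :
    Matrix (Fin 2) (Fin 2) (Matrix (ZMod p) (ZMod p) ℂ) :=
  Matrix.of
    ![![(lam * aA) • vOp p q + (-(bB / lam)) • vInv p q,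
        uOp p * ((a / sq) • vOp p q + (sq * b) • vInv p q)],
      ![uInv p * ((sq * c) • vOp p q + (d / sq) • vInv p q),
        (a * c / (aA * lam)) • vOp p q + (-(b * d * lam / bB)) • vInv p q]]

/-- The gauge matrix `G(μ|α,β) = [[1/(αβμ), β/(αμ)],[1,1]]`. -/
noncomputable def Gmat (al be mu : ℂ) : Matrix (Fin 2) (Fin 2) ℂ :=
  !![(al * be * mu)⁻¹, be / (al * mu); 1, 1]

/-- The gauge matrix `Ḡ(μ|γ) = [[1/(μγ), 0],[1,1]]`. -/
noncomputable def Gbar (ga mu : ℂ) : Matrix (Fin 2) (Fin 2) ℂ :=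
  !![(mu * ga)⁻¹, 0; 1, 1]

/-- The gauged local operators: the `2×2` matrix (over `End V`)
`G(λq^{1/2}|α,β)⁻¹ · L(λq^{−1/2}) · Ḡ(λq^{1/2}|γ)`. -/
noncomputable def gaugedLax (p : ℕ) [NeZero p] (q a b c d aA bB al be ga : ℂ)
    (lam : ℂ) : Matrix (Fin 2) (Fin 2) (Matrix (ZMod p) (ZMod p) ℂ) :=
  ((Gmat al be (lam * qhalf p q))⁻¹).map (algebraMap ℂ (Matrix (ZMod p) (ZMod p) ℂ)) *
    Lax p q (qhalf p q) a b c d aA bB (lam / qhalf p q) *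
    (Gbar ga (lam * qhalf p q)).map (algebraMap ℂ (Matrix (ZMod p) (ZMod p) ℂ))

/-- The covector `ω^{(k)}` with
`ω^{(k)}(e_h) = q^{h(k+1)} ∏_{r=1}^{h} [ρ (a q^{r−1/2} + b q^{1/2−r})/(c q^{r−1/2} + d q^{1/2−r})]^e`. -/
noncomputable def omvec (p : ℕ) (q sq a b c d rho : ℂ) (e k : ℕ) : ZMod p → ℂ :=
  fun h => q ^ (h.val * (k + 1)) *
    ∏ r ∈ Finset.Icc 1 h.val,
      (rho * (a * q ^ r / sq + b * sq / q ^ r) / (c * q ^ r / sq + d * sq / q ^ r)) ^ e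

theorem sq_qhalf (p : ℕ) (hodd : Odd p) (q : ℂ) (hq : IsPrimitiveRoot q p) :
    qhalf p q * qhalf p q = q := by
  obtain ⟨m, rfl⟩ := hodd
  unfold qhalf
  have h : (2 * m + 1 + 1) / 2 = m + 1 := by omega
  rw [h, ← pow_add]
  have : m + 1 + (m + 1) = (2 * m + 1) + 1 := by ring
  rw [this, pow_succ, hq.pow_eq_one, one_mul]

theorem prod_range_root (p : ℕ) (hodd : Odd p) (w : ℂ) (hw : IsPrimitiveRoot w p) (x y : ℂ) :
    ∏ r ∈ Finset.range p, (x + w ^ r * y) = x ^ p + y ^ p := by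
  rw [hw.pow_add_pow_eq_prod_add_mul x y hodd]
  refine Finset.prod_nbij (fun r => w ^ r) ?_ ?_ ?_ ?_
  · intro r _
    rw [Polynomial.mem_nthRootsFinset hodd.pos, ← pow_mul, mul_comm, pow_mul, hw.pow_eq_one,
      one_pow]
  · intro i hi j hj h
    exact hw.pow_inj (by simpa using hi) (by simpa using hj) h
  · intro z hz
    have hz' := (Polynomial.mem_nthRootsFinset hodd.pos (1 : ℂ)).1 hz
    have : NeZero p := ⟨hodd.pos.ne'⟩
    obtain ⟨i, hi, h⟩ := hw.eq_pow_of_pow_eq_one hz'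
    exact ⟨i, by simpa using hi, h⟩
  · intro r _
    rfl

theorem prod_Icc_range (F : ℕ → ℂ) (n : ℕ) :
    ∏ r ∈ Finset.Icc 1 n, F r = ∏ i ∈ Finset.range n, F (i + 1) := by
  induction n with
  | zero => simp
  | succ n ih => rw [Finset.prod_Icc_succ_top (by omega), ih, Finset.prod_range_succ]

theorem prod_factor (p : ℕ) (hodd : Odd p) (q : ℂ) (hq : IsPrimitiveRoot q p) (a b : ℂ) :
    ∏ r ∈ Finset.Icc 1 p, (a * q ^ r / qhalf p q + b * qhalf p q / q ^ r) =
      (∏ r ∈ Finset.Icc 1 p, (q ^ r / qhalf p q)) * (a ^ p + b ^ p) := by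
  have hs := sq_qhalf p hodd q hq
  have hq0 : q ≠ 0 := hq.ne_zero hodd.pos.ne'
  set s := qhalf p q
  have hs0 : s ≠ 0 := by
    intro h
    rw [h] at hs
    exact hq0 (by rw [← hs, zero_mul])
  have hprim : IsPrimitiveRoot ((q ^ 2)⁻¹) p := by
    apply IsPrimitiveRoot.inv
    exact hq.pow_of_coprime 2 (Nat.coprime_two_left.2 hodd)
  have key := prod_range_root p hodd _ hprim a (b / q)
  rw [div_pow, hq.pow_eq_one, div_one] at key
  rw [← key, prod_Icc_range, prod_Icc_range, ← Finset.prod_mul_distrib]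
  refine Finset.prod_congr rfl fun i _ => ?_
  have hX : q ^ i ≠ 0 := pow_ne_zero _ hq0
  rw [inv_pow, ← pow_mul, mul_comm 2 i, pow_mul, pow_succ]
  generalize q ^ i = X at *
  rw [← hs]
  field_simp

theorem factor_ne (p : ℕ) (hodd : Odd p) (q : ℂ) (hq : IsPrimitiveRoot q p) (a b : ℂ)
    (h : a ^ p + b ^ p ≠ 0) (r : ℕ) :
    a * q ^ r / qhalf p q + b * qhalf p q / q ^ r ≠ 0 := by
  have hs := sq_qhalf p hodd q hq
  have hq0 : q ≠ 0 := hq.ne_zero hodd.pos.ne'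
  have hsp : qhalf p q ^ p = 1 := by
    unfold qhalf
    rw [← pow_mul, mul_comm, pow_mul, hq.pow_eq_one, one_pow]
  have hqp : (q ^ r) ^ p = 1 := by
    rw [← pow_mul, mul_comm, pow_mul, hq.pow_eq_one, one_pow]
  intro h0
  have h1 := congrArg (· ^ p) (eq_neg_of_add_eq_zero_left h0)
  simp only [hodd.neg_pow, div_pow, mul_pow, hsp, hqp] at h1
  apply h
  rw [eq_neg_iff_add_eq_zero] at h1
  simpa using h1

theorem om_succ (p : ℕ) [NeZero p] (hodd : Odd p) (hp3 : 3 ≤ p)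
    (q : ℂ) (hq : IsPrimitiveRoot q p) (a b c d rho : ℂ)
    (habp : a ^ p + b ^ p ≠ 0) (hcdp : c ^ p + d ^ p ≠ 0)
    (hrho : rho ^ p = (c ^ p + d ^ p) / (a ^ p + b ^ p)) (e k : ℕ) (h : ZMod p) :
    omvec p q (qhalf p q) a b c d rho e k (h + 1) =
      omvec p q (qhalf p q) a b c d rho e k h * q ^ (k + 1) *
        (rho * (a * q ^ (h.val + 1) / qhalf p q + b * qhalf p q / q ^ (h.val + 1)) /
          (c * q ^ (h.val + 1) / qhalf p q + d * qhalf p q / q ^ (h.val + 1))) ^ e := by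
  have hq0 : q ≠ 0 := hq.ne_zero hodd.pos.ne'
  have hs := sq_qhalf p hodd q hq
  have hs0 : qhalf p q ≠ 0 := pow_ne_zero _ hq0
  have hv : (h + 1).val = (h.val + 1) % p := by
    rw [ZMod.val_add, ZMod.val_one'' (by omega)]
  have step : q ^ (h.val * (k + 1)) * (∏ r ∈ Finset.Icc 1 h.val,
      (rho * (a * q ^ r / qhalf p q + b * qhalf p q / q ^ r) /
        (c * q ^ r / qhalf p q + d * qhalf p q / q ^ r)) ^ e) * q ^ (k + 1) *
        (rho * (a * q ^ (h.val + 1) / qhalf p q + b * qhalf p q / q ^ (h.val + 1)) /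
          (c * q ^ (h.val + 1) / qhalf p q + d * qhalf p q / q ^ (h.val + 1))) ^ e =
      q ^ ((h.val + 1) * (k + 1)) * ∏ r ∈ Finset.Icc 1 (h.val + 1),
      (rho * (a * q ^ r / qhalf p q + b * qhalf p q / q ^ r) /
        (c * q ^ r / qhalf p q + d * qhalf p q / q ^ r)) ^ e := by
    rw [Finset.prod_Icc_succ_top (by omega)]
    ring
  unfold omvec
  rw [step, hv]
  rcases Nat.lt_or_ge (h.val + 1) p with hlt | hge
  · rw [Nat.mod_eq_of_lt hlt]
  · have hlt := ZMod.val_lt h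
    have heq : h.val + 1 = p := by omega
    rw [heq, Nat.mod_self, pow_mul q p, hq.pow_eq_one, Finset.Icc_eq_empty (by omega : ¬ 1 ≤ 0),
      Finset.prod_empty, Finset.prod_pow, Finset.prod_div_distrib,
      Finset.prod_mul_distrib, prod_factor p hodd q hq a b, prod_factor p hodd q hq c d,
      Finset.prod_const, Nat.card_Icc, Nat.add_sub_cancel, hrho]
    have hK : ∏ r ∈ Finset.Icc 1 p, (q ^ r / qhalf p q) ≠ 0 :=
      Finset.prod_ne_zero_iff.2 fun r _ => div_ne_zero (pow_ne_zero _ hq0) hs0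
    have : (c ^ p + d ^ p) / (a ^ p + b ^ p) *
        ((∏ r ∈ Finset.Icc 1 p, (q ^ r / qhalf p q)) * (a ^ p + b ^ p)) /
        ((∏ r ∈ Finset.Icc 1 p, (q ^ r / qhalf p q)) * (c ^ p + d ^ p)) = 1 := by
      field_simp
    rw [this]
    simp

theorem q_val_succ (p : ℕ) [NeZero p] (hp3 : 3 ≤ p) (q : ℂ) (hq : IsPrimitiveRoot q p)
    (h : ZMod p) : q ^ (h + 1).val = q ^ (h.val + 1) := by
  rw [ZMod.val_add, ZMod.val_one'' (by omega)]
  conv_rhs => rw [← Nat.mod_add_div (h.val + 1) p, pow_add, pow_mul, hq.pow_eq_one]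
  simp

theorem vecMul_vOp (p : ℕ) [NeZero p] (q : ℂ) (f : ZMod p → ℂ) (h : ZMod p) :
    Matrix.vecMul f (vOp p q) h = f h * q ^ h.val := by
  simp [Matrix.vecMul, dotProduct, vOp]

theorem vecMul_vInv (p : ℕ) [NeZero p] (q : ℂ) (f : ZMod p → ℂ) (h : ZMod p) :
    Matrix.vecMul f (vInv p q) h = f h * (q ^ h.val)⁻¹ := by
  simp [Matrix.vecMul, dotProduct, vInv]

theorem vecMul_uOp (p : ℕ) [NeZero p] (f : ZMod p → ℂ) (h : ZMod p) :
    Matrix.vecMul f (uOp p) h = f (h - 1) := by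
  simp only [Matrix.vecMul, dotProduct, uOp, Matrix.of_apply, mul_ite, mul_one, mul_zero]
  rw [Finset.sum_eq_single (h - 1)]
  · simp
  · intro i _ hi
    rw [if_neg]
    rintro rfl
    simp at hi
  · simp

theorem vecMul_uInv (p : ℕ) [NeZero p] (f : ZMod p → ℂ) (h : ZMod p) :
    Matrix.vecMul f (uInv p) h = f (h + 1) := by
  simp only [Matrix.vecMul, dotProduct, uInv, Matrix.of_apply, mul_ite, mul_one, mul_zero]
  rw [Finset.sum_eq_single (h + 1)]
  · simp
  · intro i _ hi
    rw [if_neg]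
    rintro rfl
    simp at hi
  · simp

theorem Gmat_inv (al be mu : ℂ) (hal : al ≠ 0) (hbe : be ≠ 0) (hmu : mu ≠ 0)
    (hbe2 : be ^ 2 ≠ 1) :
    (Gmat al be mu)⁻¹ 0 0 = be ^ 2 / (be ^ 2 - 1) * (-(mu / (be / al))) ∧
    (Gmat al be mu)⁻¹ 0 1 = be ^ 2 / (be ^ 2 - 1) := by
  have h1 : be ^ 2 - 1 ≠ 0 := sub_ne_zero.2 hbe2
  have h2 : 1 - be ^ 2 ≠ 0 := sub_ne_zero.2 hbe2.symm
  have hdet : (Gmat al be mu).det = (1 - be ^ 2) / (al * be * mu) := by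
    rw [Gmat, Matrix.det_fin_two_of]
    field_simp
  rw [Matrix.inv_def, hdet, Gmat, Matrix.adjugate_fin_two_of, Ring.inverse_eq_inv']
  constructor
  · simp
    field_simp
    ring
  · simp
    field_simp
    ring

theorem vecMul_A (p : ℕ) [NeZero p] (q a b c d aA bB al be ga lam : ℂ)
    (f : ZMod p → ℂ) (h : ZMod p)
    (hal : al ≠ 0) (hbe : be ≠ 0) (hmu : lam * qhalf p q ≠ 0) (hbe2 : be ^ 2 ≠ 1) :
    Matrix.vecMul f (gaugedLax p q a b c d aA bB al be ga lam 0 0) h =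
      be ^ 2 / (be ^ 2 - 1) * (
        -((lam * qhalf p q) / (be / al)) *
          ((lam * qhalf p q * ga)⁻¹ *
            (lam / qhalf p q * aA * q ^ h.val - bB / (lam / qhalf p q) / q ^ h.val) * f h +
           f (h - 1) * (a / qhalf p q * q ^ h.val + qhalf p q * b / q ^ h.val)) +
        ((lam * qhalf p q * ga)⁻¹ *
          (f (h + 1) * (qhalf p q * c * q ^ h.val + d / qhalf p q / q ^ h.val)) +
          (a * c / (aA * (lam / qhalf p q)) * q ^ h.val
            - b * d * (lam / qhalf p q) / bB / q ^ h.val) * f h)) := by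
  obtain ⟨h0, h1⟩ := Gmat_inv al be (lam * qhalf p q) hal hbe hmu hbe2
  simp only [gaugedLax, Matrix.mul_apply, Fin.sum_univ_two, Matrix.map_apply, h0, h1,
    ← Algebra.smul_def, ← Algebra.commutes, Lax, Gbar]
  simp only [Matrix.of_apply, Matrix.cons_val_zero, Matrix.cons_val_one,
    Matrix.vecMul_add, Matrix.vecMul_smul, ← Matrix.vecMul_vecMul, Pi.add_apply, Pi.smul_apply,
    vecMul_vOp, vecMul_vInv, vecMul_uOp, vecMul_uInv, smul_eq_mul, smul_add,
    Matrix.cons_val', Matrix.cons_val_fin_one]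
  ring

theorem vecMul_B (p : ℕ) [NeZero p] (q a b c d aA bB al be ga lam : ℂ)
    (f : ZMod p → ℂ) (h : ZMod p)
    (hal : al ≠ 0) (hbe : be ≠ 0) (hmu : lam * qhalf p q ≠ 0) (hbe2 : be ^ 2 ≠ 1) :
    Matrix.vecMul f (gaugedLax p q a b c d aA bB al be ga lam 0 1) h =
      be ^ 2 / (be ^ 2 - 1) * (
        -((lam * qhalf p q) / (be / al)) *
           (f (h - 1) * (a / qhalf p q * q ^ h.val + qhalf p q * b / q ^ h.val)) +
          (a * c / (aA * (lam / qhalf p q)) * q ^ h.val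
            - b * d * (lam / qhalf p q) / bB / q ^ h.val) * f h) := by
  obtain ⟨h0, h1⟩ := Gmat_inv al be (lam * qhalf p q) hal hbe hmu hbe2
  simp only [gaugedLax, Matrix.mul_apply, Fin.sum_univ_two, Matrix.map_apply, h0, h1,
    ← Algebra.smul_def, ← Algebra.commutes, Lax, Gbar]
  simp only [Matrix.of_apply, Matrix.cons_val_zero, Matrix.cons_val_one,
    Matrix.vecMul_add, Matrix.vecMul_smul, ← Matrix.vecMul_vecMul, Pi.add_apply, Pi.smul_apply,
    vecMul_vOp, vecMul_vInv, vecMul_uOp, vecMul_uInv, smul_eq_mul, smul_add,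
    Matrix.cons_val', Matrix.cons_val_fin_one]
  ring

/-- Local pseudo-reference covector for the gauged
Bazhanov–Stroganov Lax operator: under the gauge constraints
`β/α = w^{(ε,k)}`, `γ = z^{(ε,k)}`, the covector `ω^{(k)}` annihilates
`A(λ|α,β,γ)` and is a pseudo-eigenvector of `B(λ|α,β)` with explicit
pseudo-eigenvalue `b(λ)`. -/
theorem stmt_17 (p : ℕ) [NeZero p] (hodd : Odd p) (hp3 : 3 ≤ p)
    (q : ℂ) (hq : IsPrimitiveRoot q p)
    (a b c d aA bB : ℂ)
    (ha : a ≠ 0) (hb : b ≠ 0) (hc : c ≠ 0) (hd : d ≠ 0) (haA : aA ≠ 0) (hbB : bB ≠ 0)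
    (habp : a ^ p + b ^ p ≠ 0) (hcdp : c ^ p + d ^ p ≠ 0)
    (rho : ℂ) (hrho : rho ^ p = (c ^ p + d ^ p) / (a ^ p + b ^ p))
    (eps : ℤ) (heps : eps = 1 ∨ eps = -1) (k : ℕ) (hk : k < p)
    (al be ga : ℂ) (hal : al ≠ 0) (hbe : be ≠ 0) (hga : ga ≠ 0) (hbe2 : be ^ 2 ≠ 1)
    (hw : be / al =
      -(qhalf p q / q ^ k) * (d / (rho * b)) ^ ((1 + eps) / 2).toNat * (bB / d))
    (hz : ga =
      -(q ^ k * qhalf p q) * (rho * a / c) ^ ((1 + eps) / 2).toNat * (aA / a)) :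
    (∀ lam : ℂ, lam ≠ 0 →
      Matrix.vecMul (omvec p q (qhalf p q) a b c d rho ((1 + eps) / 2).toNat k)
        (gaugedLax p q a b c d aA bB al be ga lam 0 0) = 0) ∧
    (∀ lam : ℂ, lam ≠ 0 →
      Matrix.vecMul (omvec p q (qhalf p q) a b c d rho ((1 + eps) / 2).toNat k)
        (gaugedLax p q a b c d aA bB al be ga lam 0 1) =
      ((be ^ 2 / (be ^ 2 - 1)) *
          (qhalf p q * (a * c / aA) / lam +
            lam / (q * qhalf p q) * (if eps = -1 then a * d / bB else b * c / bB))) •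
        omvec p q (qhalf p q) a b c d rho ((1 + eps) / 2).toNat (k + 1)) := by
  have hq0 : q ≠ 0 := hq.ne_zero hodd.pos.ne'
  have hs := sq_qhalf p hodd q hq
  have hs0 : qhalf p q ≠ 0 := pow_ne_zero _ hq0
  have hr0 : rho ≠ 0 := by
    rintro rfl
    rw [zero_pow hodd.pos.ne'] at hrho
    exact div_ne_zero hcdp habp hrho.symm
  have hsucc := fun e h =>
    om_succ p hodd hp3 q hq a b c d rho habp hcdp hrho e k h
  have hk1 : ∀ e h, omvec p q (qhalf p q) a b c d rho e (k + 1) h =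
      omvec p q (qhalf p q) a b c d rho e k h * q ^ h.val := by
    intro e h
    unfold omvec
    ring
  have hqk0 : q ^ k ≠ 0 := pow_ne_zero _ hq0
  have hprev : ∀ e h, omvec p q (qhalf p q) a b c d rho e k h =
      omvec p q (qhalf p q) a b c d rho e k (h - 1) * (q ^ k * q) *
        (rho * (a * q ^ h.val / qhalf p q + b * qhalf p q / q ^ h.val) /
          (c * q ^ h.val / qhalf p q + d * qhalf p q / q ^ h.val)) ^ e := by
    intro e h
    have h1 := hsucc e (h - 1)
    rw [← q_val_succ p hp3 q hq (h - 1), sub_add_cancel, pow_succ] at h1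
    exact h1
  have hN := factor_ne p hodd q hq a b habp
  have hD := factor_ne p hodd q hq c d hcdp
  rcases heps with rfl | rfl
  · have he : ((1 + 1 : ℤ) / 2).toNat = 1 := by decide
    have hif : ¬ ((1 : ℤ) = -1) := by decide
    rw [he] at hw hz ⊢
    simp only [hif, if_false]
    simp only [pow_one] at hw hz
    -- the two shift relations
    have hm : ∀ h, omvec p q (qhalf p q) a b c d rho 1 k (h - 1) *
        (a / qhalf p q * q ^ h.val + qhalf p q * b / q ^ h.val) =
        omvec p q (qhalf p q) a b c d rho 1 k h *
          (c * q ^ h.val / qhalf p q + d * qhalf p q / q ^ h.val) / (q ^ k * q * rho) := by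
      intro h
      rw [hprev 1 h, pow_one]
      have h1 := hD h.val
      generalize c * q ^ h.val / qhalf p q + d * qhalf p q / q ^ h.val = D at *
      field_simp
    have hpl : ∀ h, omvec p q (qhalf p q) a b c d rho 1 k (h + 1) *
        (qhalf p q * c * q ^ h.val + d / qhalf p q / q ^ h.val) =
        omvec p q (qhalf p q) a b c d rho 1 k h * (q ^ k * q * rho) *
          (qhalf p q * a * q ^ h.val + b / qhalf p q / q ^ h.val) := by
      intro h
      rw [hsucc 1 h, pow_one]
      have h1 := hD (h.val + 1)
      have e1 : ∀ x y : ℂ, x * q ^ (h.val + 1) / qhalf p q + y * qhalf p q / q ^ (h.val + 1) =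
          qhalf p q * x * q ^ h.val + y / qhalf p q / q ^ h.val := by
        intro x y
        have hx0 : q ^ h.val ≠ 0 := pow_ne_zero _ hq0
        rw [pow_succ]
        generalize q ^ h.val = X at *
        generalize qhalf p q = s at *
        rw [← hs]
        field_simp
      rw [e1] at h1
      rw [e1, e1]
      generalize qhalf p q * c * q ^ h.val + d / qhalf p q / q ^ h.val = D at *
      rw [pow_succ]
      field_simp
    refine ⟨fun lam hlam => funext fun h => ?_, fun lam hlam => funext fun h => ?_⟩
    · rw [vecMul_A p q a b c d aA bB al be ga lam _ h hal hbe (mul_ne_zero hlam hs0) hbe2, hm, hpl,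
        hw, hz]
      rw [Pi.zero_apply]
      refine mul_eq_zero_of_right _ ?_
      have hx0 : q ^ h.val ≠ 0 := pow_ne_zero _ hq0
      generalize omvec p q (qhalf p q) a b c d rho 1 k h = f
      generalize q ^ h.val = X at *
      generalize q ^ k = Q at *
      generalize qhalf p q = s at *
      subst hs
      field_simp
      ring
    · rw [vecMul_B p q a b c d aA bB al be ga lam _ h hal hbe (mul_ne_zero hlam hs0) hbe2, hm,
        hw]
      rw [Pi.smul_apply, smul_eq_mul, hk1]
      refine Eq.trans ?_ (mul_assoc _ _ _).symm
      congr 1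
      have hx0 : q ^ h.val ≠ 0 := pow_ne_zero _ hq0
      generalize omvec p q (qhalf p q) a b c d rho 1 k h = f
      generalize q ^ h.val = X at *
      generalize q ^ k = Q at *
      generalize qhalf p q = s at *
      subst hs
      field_simp
      ring
  · have he : ((1 + -1 : ℤ) / 2).toNat = 0 := by decide
    rw [he] at hw hz ⊢
    simp only [if_true]
    simp only [pow_zero, mul_one] at hw hz
    have hm : ∀ h, omvec p q (qhalf p q) a b c d rho 0 k (h - 1) =
        omvec p q (qhalf p q) a b c d rho 0 k h / (q ^ k * q) := by
      intro h
      rw [hprev 0 h, pow_zero]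
      field_simp
    have hpl : ∀ h, omvec p q (qhalf p q) a b c d rho 0 k (h + 1) =
        omvec p q (qhalf p q) a b c d rho 0 k h * (q ^ k * q) := by
      intro h
      rw [hsucc 0 h, pow_zero, pow_succ]
      ring
    refine ⟨fun lam hlam => funext fun h => ?_, fun lam hlam => funext fun h => ?_⟩
    · rw [vecMul_A p q a b c d aA bB al be ga lam _ h hal hbe (mul_ne_zero hlam hs0) hbe2, hm, hpl,
        hw, hz]
      rw [Pi.zero_apply]
      refine mul_eq_zero_of_right _ ?_
      have hx0 : q ^ h.val ≠ 0 := pow_ne_zero _ hq0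
      generalize omvec p q (qhalf p q) a b c d rho 0 k h = f
      generalize q ^ h.val = X at *
      generalize q ^ k = Q at *
      generalize qhalf p q = s at *
      subst hs
      field_simp
      ring
    · rw [vecMul_B p q a b c d aA bB al be ga lam _ h hal hbe (mul_ne_zero hlam hs0) hbe2, hm,
        hw]
      rw [Pi.smul_apply, smul_eq_mul, hk1]
      refine Eq.trans ?_ (mul_assoc _ _ _).symm
      congr 1
      have hx0 : q ^ h.val ≠ 0 := pow_ne_zero _ hq0
      generalize omvec p q (qhalf p q) a b c d rho 0 k h = f
      generalize q ^ h.val = X at *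
      generalize q ^ k = Q at *
      generalize qhalf p q = s at *
      subst hs
      field_simp
      ring
end
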